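/- There exists an increasing sequence (K_n) of compact subsets of ℂ whose union is all of ℂ, and a sequence (D_n) of Dirichlet polynomials, such that for every n: (1) |D_n(z) − ζ(z)| ≤ 1/n for all z ∈ K_n \ {1}; (2) D_n(1) = n; (3) for every z ∈ K_n ∩ (ℝ ∪ S), D_n(z) = 0 if and only if ζ(z) = 0, and every such zero of D_n is simple (i.e. D_n′(z) ≠ 0 there); (4) D_n has no zeros on K_n \ (ℝ ∪ S); and (5) D_n maps ℝ into ℝ. -/

import Mathlib

open Complex Set

/-- A Dirichlet polynomial: a function of the form `z ↦ ∑_{k=1}^m a_k k^{-z}`. -/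
def IsDirichletPolynomial (f : ℂ → ℂ) : Prop :=
  ∃ (m : ℕ) (a : ℕ → ℂ), ∀ z : ℂ, f z = ∑ k ∈ Finset.Icc 1 m, a k * (k : ℂ) ^ (-z)

/-- The real axis together with the critical line, as a subset of `ℂ`. -/
def realAxisUnionCriticalLine : Set ℂ :=
  {z : ℂ | z.im = 0} ∪ {z : ℂ | z.re = 1 / 2}

/-- An entire function vanishing at finitely many points is divisible by the corresponding
product of linear factors. -/
lemma exists_entire_eq_prod_mul (s : Finset ℂ) {F : ℂ → ℂ} (hF : Differentiable ℂ F)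
    (h0 : ∀ a ∈ s, F a = 0) :
    ∃ G : ℂ → ℂ, Differentiable ℂ G ∧ ∀ w, F w = (∏ a ∈ s, (w - a)) * G w := by
  induction s using Finset.induction_on with
  | empty => exact ⟨F, hF, by simp⟩
  | insert a s ha ih =>
    obtain ⟨G, hG, hFG⟩ := ih fun b hb => h0 b (Finset.mem_insert_of_mem hb)
    have hGa : G a = 0 := by
      have h := h0 a (Finset.mem_insert_self a s)
      rw [hFG] at h
      refine (mul_eq_zero.1 h).resolve_left (Finset.prod_ne_zero_iff.2 fun b hb => ?_)
      exact sub_ne_zero.2 fun h => ha (h ▸ hb)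
    refine ⟨dslope G a, ?_, fun w => ?_⟩
    · rw [← differentiableOn_univ] at hG ⊢
      exact (Complex.differentiableOn_dslope Filter.univ_mem).2 hG
    · have h := sub_smul_dslope G a w
      rw [hGa, sub_zero, smul_eq_mul] at h
      rw [hFG, Finset.prod_insert ha, ← h]
      ring

/-- An entire function of exponential type vanishing at `log k` for all `k ≥ 1` is zero. -/
lemma entire_eq_zero_of_log_zeros {F : ℂ → ℂ} (hF : Differentiable ℂ F) {C R : ℝ}
    (hbound : ∀ w, ‖F w‖ ≤ C * Real.exp (R * ‖w‖))
    (h0 : ∀ k : ℕ, 1 ≤ k → F (Real.log k : ℂ) = 0) (w : ℂ) : F w = 0 := by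
  have key : ∀ m : ℕ, 2 ≤ m →
      ‖F w‖ ≤ C * Real.exp (R * (2 * ‖w‖ + 3 * Real.log m)) * (1 / 2) ^ m := by
    intro m hm
    set ρ : ℝ := 2 * ‖w‖ + 3 * Real.log m with hρ
    have hlogm : 0 < Real.log m := Real.log_pos (by exact_mod_cast hm)
    let s : Finset ℂ := (Finset.Icc 1 m).image fun k : ℕ => (Real.log k : ℂ)
    have hs : ∀ a ∈ s, 0 ≤ ‖a‖ ∧ ‖a‖ ≤ Real.log m := by
      intro a ha
      obtain ⟨k, hk, rfl⟩ := Finset.mem_image.1 ha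
      rw [Finset.mem_Icc] at hk
      have h1 : (1 : ℝ) ≤ k := by exact_mod_cast hk.1
      rw [Complex.norm_real, Real.norm_of_nonneg (Real.log_nonneg h1)]
      exact ⟨Real.log_nonneg h1, Real.log_le_log (by linarith) (by exact_mod_cast hk.2)⟩
    have hcard : s.card = m := by
      rw [Finset.card_image_of_injOn, Nat.card_Icc, Nat.add_sub_cancel]
      intro k hk l hl hkl
      simp only [Finset.coe_Icc, Set.mem_Icc] at hk hl
      have := Real.log_injOn_pos (by simp; omega) (by simp; omega) (Complex.ofReal_injective hkl)
      exact_mod_cast this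
    obtain ⟨G, hG, hFG⟩ := exists_entire_eq_prod_mul s hF (by
      intro a ha
      obtain ⟨k, hk, rfl⟩ := Finset.mem_image.1 ha
      exact h0 k (Finset.mem_Icc.1 hk).1)
    have hρpos : 0 < ρ := by positivity
    have hd : 0 < ρ - Real.log m := by rw [hρ]; nlinarith [norm_nonneg w]
    have hGw : ‖G w‖ ≤ C * Real.exp (R * ρ) / (ρ - Real.log m) ^ m := by
      refine Complex.norm_le_of_forall_mem_frontier_norm_le (U := Metric.ball 0 ρ)
        Metric.isBounded_ball hG.diffContOnCl ?_ (subset_closure ?_)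
      · intro z hz
        rw [frontier_ball _ hρpos.ne', mem_sphere_zero_iff_norm] at hz
        rw [le_div_iff₀ (by positivity), ← hz]
        refine le_trans ?_ (hbound z)
        rw [hFG z, norm_mul, mul_comm, norm_prod, hz]
        gcongr
        rw [← hcard, ← Finset.prod_const]
        refine Finset.prod_le_prod (fun _ _ => hcard ▸ hd.le) fun a ha => ?_
        have := norm_sub_norm_le z a
        have := (hs a ha).2
        rw [hcard]
        linarith
      · rw [mem_ball_zero_iff, hρ]
        nlinarith [norm_nonneg w]
    have hprod : ‖∏ a ∈ s, (w - a)‖ ≤ ((1 / 2) * (ρ - Real.log m)) ^ m := by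
      rw [norm_prod]
      nth_rw 2 [← hcard]
      rw [← Finset.prod_const]
      refine Finset.prod_le_prod (fun _ _ => norm_nonneg _) fun a ha => ?_
      have := norm_sub_le w a
      have := (hs a ha).2
      rw [hρ]
      linarith
    calc ‖F w‖ = ‖∏ a ∈ s, (w - a)‖ * ‖G w‖ := by rw [hFG, norm_mul]
      _ ≤ ((1 / 2) * (ρ - Real.log m)) ^ m * (C * Real.exp (R * ρ) / (ρ - Real.log m) ^ m) := by
        gcongr
      _ = C * Real.exp (R * ρ) * (1 / 2) ^ m := by
        rw [mul_pow]
        field_simp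
  obtain ⟨j, hj⟩ := exists_nat_ge (3 * R)
  have hC : 0 ≤ C := by
    have := (norm_nonneg _).trans (hbound 0)
    simpa using this
  have hle : ∀ m : ℕ, 2 ≤ m →
      ‖F w‖ ≤ C * Real.exp (R * (2 * ‖w‖)) * ((m : ℝ) ^ j * (1 / 2) ^ m) := by
    intro m hm
    refine (key m hm).trans ?_
    have hm0 : (0 : ℝ) < m := by positivity
    have hlogm : 0 < Real.log m := Real.log_pos (by exact_mod_cast hm)
    have h1 : Real.exp (3 * R * Real.log m) ≤ (m : ℝ) ^ j := by
      calc Real.exp (3 * R * Real.log m) ≤ Real.exp (j * Real.log m) := by gcongr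
        _ = (m : ℝ) ^ j := by rw [Real.exp_nat_mul, Real.exp_log hm0]
    rw [mul_add, Real.exp_add, show R * (3 * Real.log m) = 3 * R * Real.log m by ring]
    calc C * (Real.exp (R * (2 * ‖w‖)) * Real.exp (3 * R * Real.log m)) * (1 / 2) ^ m
        ≤ C * (Real.exp (R * (2 * ‖w‖)) * (m : ℝ) ^ j) * (1 / 2) ^ m := by gcongr
      _ = _ := by ring
  have hlim := (tendsto_pow_const_mul_const_pow_of_lt_one j (r := 1 / 2) (by norm_num)
    (by norm_num)).const_mul (C * Real.exp (R * (2 * ‖w‖)))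
  rw [mul_zero] at hlim
  have := ge_of_tendsto hlim (Filter.eventually_atTop.2 ⟨2, hle⟩)
  exact norm_le_zero_iff.1 this

/-- The algebra of functions on `ℂ` generated by `z ↦ k ^ (-z)`, `k ≥ 1`. -/
noncomputable def dirichletAlgebra : Subalgebra ℂ (ℂ → ℂ) :=
  Algebra.adjoin ℂ (range fun (k : ℕ+) (z : ℂ) => (k : ℂ) ^ (-z))

/-- The function `z ↦ k ^ (-z)` on a subset of the plane. -/
noncomputable def dirichletMonomialOn (K : Set ℂ) (k : ℕ+) : C(K, ℂ) where
  toFun z := (k : ℂ) ^ (-(z : ℂ))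
  continuous_toFun := by
    have : NeZero (k : ℂ) := ⟨by exact_mod_cast k.ne_zero⟩
    fun_prop

/-- The algebra of restrictions of Dirichlet polynomials to a subset of the plane. -/
noncomputable def dirichletAlgebraOn (K : Set ℂ) : Subalgebra ℂ C(K, ℂ) :=
  Algebra.adjoin ℂ (range (dirichletMonomialOn K))

lemma exists_mem_dirichletAlgebra_eqOn {K : Set ℂ} {f : C(K, ℂ)} (hf : f ∈ dirichletAlgebraOn K) :
    ∃ D ∈ dirichletAlgebra, ∀ z : K, f z = D z := by
  induction hf using Algebra.adjoin_induction with
  | mem f hf =>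
    obtain ⟨k, rfl⟩ := hf
    exact ⟨_, Algebra.subset_adjoin ⟨k, rfl⟩, fun z => rfl⟩
  | algebraMap r => exact ⟨_, dirichletAlgebra.algebraMap_mem r, fun z => rfl⟩
  | add f g _ _ hf hg =>
    obtain ⟨D, hD, hfD⟩ := hf
    obtain ⟨E, hE, hgE⟩ := hg
    exact ⟨D + E, add_mem hD hE, fun z => by simp [hfD, hgE]⟩
  | mul f g _ _ hf hg =>
    obtain ⟨D, hD, hfD⟩ := hf
    obtain ⟨E, hE, hgE⟩ := hg
    exact ⟨D * E, mul_mem hD hE, fun z => by simp [hfD, hgE]⟩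

lemma differentiable_of_mem_dirichletAlgebra {D : ℂ → ℂ} (hD : D ∈ dirichletAlgebra) :
    Differentiable ℂ D := by
  induction hD using Algebra.adjoin_induction with
  | mem f hf =>
    obtain ⟨k, rfl⟩ := hf
    exact differentiable_neg.const_cpow (Or.inl (by exact_mod_cast k.ne_zero))
  | algebraMap r => exact differentiable_const r
  | add f g _ _ hf hg => exact hf.add hg
  | mul f g _ _ hf hg => exact hf.mul hg

open ComplexConjugate in
lemma conj_conj_mem_dirichletAlgebra {D : ℂ → ℂ} (hD : D ∈ dirichletAlgebra) :
    (fun z => conj (D (conj z))) ∈ dirichletAlgebra := by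
  induction hD using Algebra.adjoin_induction with
  | mem f hf =>
    obtain ⟨k, rfl⟩ := hf
    refine Algebra.subset_adjoin ⟨k, funext fun z => ?_⟩
    have h := Complex.cpow_conj (k : ℂ) (-z) (by
      rw [Complex.natCast_arg]; exact Real.pi_pos.ne)
    simp only [map_neg, Complex.conj_natCast] at h
    simp [h]
  | algebraMap r => exact dirichletAlgebra.algebraMap_mem (conj r)
  | add f g _ _ hf hg =>
    convert! add_mem hf hg using 1
    ext z
    simp
  | mul f g _ _ hf hg =>
    convert! mul_mem hf hg using 1
    ext z
    simp

lemma IsDirichletPolynomial.add {f g : ℂ → ℂ} (hf : IsDirichletPolynomial f)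
    (hg : IsDirichletPolynomial g) : IsDirichletPolynomial (f + g) := by
  obtain ⟨m, a, hf⟩ := hf
  obtain ⟨n, b, hg⟩ := hg
  have extend : ∀ (m M : ℕ) (a : ℕ → ℂ) (z : ℂ), m ≤ M →
      ∑ k ∈ Finset.Icc 1 m, a k * (k : ℂ) ^ (-z) =
        ∑ k ∈ Finset.Icc 1 M, (if k ≤ m then a k else 0) * (k : ℂ) ^ (-z) := by
    intro m M a z hM
    rw [← Finset.sum_subset (Finset.Icc_subset_Icc_right hM)]
    · refine Finset.sum_congr rfl fun k hk => ?_
      rw [if_pos (Finset.mem_Icc.1 hk).2]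
    · intro k hk hkm
      rw [Finset.mem_Icc] at hk hkm
      rw [if_neg (by omega), zero_mul]
  refine ⟨max m n, fun k => (if k ≤ m then a k else 0) + (if k ≤ n then b k else 0), fun z => ?_⟩
  rw [Pi.add_apply, hf, hg, extend m _ a z (le_max_left m n), extend n _ b z (le_max_right m n),
    ← Finset.sum_add_distrib]
  exact Finset.sum_congr rfl fun k _ => by ring

lemma isDirichletPolynomial_of_mem_dirichletAlgebra {D : ℂ → ℂ} (hD : D ∈ dirichletAlgebra) :
    IsDirichletPolynomial D := by
  rw [dirichletAlgebra, ← Subalgebra.mem_toSubmodule, Algebra.adjoin_eq_span] at hD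
  induction hD using Submodule.span_induction with
  | mem f hf =>
    have hmono : ∃ k : ℕ+, f = fun z => (k : ℂ) ^ (-z) := by
      induction hf using Submonoid.closure_induction with
      | mem f hf => obtain ⟨k, rfl⟩ := hf; exact ⟨k, rfl⟩
      | one => exact ⟨1, by ext z; simp⟩
      | mul f g _ _ hf hg =>
        obtain ⟨k, rfl⟩ := hf
        obtain ⟨l, rfl⟩ := hg
        refine ⟨k * l, funext fun z => ?_⟩
        simp [Complex.natCast_mul_natCast_cpow]
    obtain ⟨k, rfl⟩ := hmono
    refine ⟨k, fun j => if j = (k : ℕ) then 1 else 0, fun z => ?_⟩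
    rw [Finset.sum_eq_single (k : ℕ)]
    · simp
    · intro j _ hj
      simp [hj]
    · intro hk
      exact absurd (Finset.mem_Icc.2 ⟨k.pos, le_rfl⟩) hk
  | zero => exact ⟨0, 0, fun z => by simp⟩
  | add f g _ _ hf hg => exact hf.add hg
  | smul c f _ hf =>
    obtain ⟨m, a, hf⟩ := hf
    exact ⟨m, fun k => c * a k, fun z => by simp [hf, Finset.mul_sum, mul_assoc]⟩

variable {K : Set ℂ}

/-- The coordinate function on a subset of the plane. -/
def coordinateOn (K : Set ℂ) : C(K, ℂ) := ⟨Subtype.val, continuous_subtype_val⟩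

lemma exp_smul_coordinateOn_apply [CompactSpace K] (w : ℂ) (z : K) :
    NormedSpace.exp (w • coordinateOn K) z = Complex.exp (w * z) := by
  have h := NormedSpace.map_exp_of_mem_ball (𝕂 := ℂ)
    ((Pi.evalRingHom (fun _ : K => ℂ) z).comp ContinuousMap.coeFnRingHom)
    (continuous_eval_const z) (w • coordinateOn K)
    ((NormedSpace.expSeries_radius_eq_top ℂ C(K, ℂ)).symm ▸ edist_lt_top _ _)
  rw [Complex.exp_eq_exp_ℂ]
  exact h

lemma coordinateOn_mem_topologicalClosure [CompactSpace K] :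
    coordinateOn K ∈ (dirichletAlgebraOn K).topologicalClosure := by
  set A := (dirichletAlgebraOn K).topologicalClosure with hA
  by_contra hX
  let S : Submodule ℂ C(K, ℂ) := Subalgebra.toSubmodule A
  have : IsClosed (S : Set C(K, ℂ)) := Subalgebra.isClosed_topologicalClosure _
  have hXq : S.mkQ (coordinateOn K) ≠ 0 := by
    rw [Submodule.mkQ_apply, ne_eq, Submodule.Quotient.mk_eq_zero]
    exact hX
  obtain ⟨ψ, hψ⟩ := SeparatingDual.exists_eq_one (R := ℂ) hXq
  let φ : C(K, ℂ) →L[ℂ] ℂ := ψ.comp S.mkQL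
  have hφA : ∀ f ∈ A, φ f = 0 := by
    intro f hf
    have : S.mkQ f = 0 := by
      rw [Submodule.mkQ_apply, Submodule.Quotient.mk_eq_zero]
      exact hf
    change ψ (S.mkQ f) = 0
    rw [this, map_zero]
  let F : ℂ → ℂ := fun w => φ (NormedSpace.exp ((-w) • coordinateOn K))
  have hderiv : ∀ w, HasDerivAt F
      (φ (-(NormedSpace.exp ((-w) • coordinateOn K) * coordinateOn K))) w := by
    intro w
    have h := (hasDerivAt_exp_smul_const (coordinateOn K) (-w)).scomp w (hasDerivAt_neg w)
    rw [neg_one_smul] at h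
    exact φ.hasFDerivAt.comp_hasDerivAt w h
  have hF0 : ∀ w, F w = 0 := by
    refine entire_eq_zero_of_log_zeros (C := ‖φ‖) (R := ‖coordinateOn K‖)
      (fun w => (hderiv w).differentiableAt) (fun w => ?_) fun k hk => ?_
    · refine (φ.le_opNorm _).trans ?_
      gcongr
      refine (ContinuousMap.norm_le _ (Real.exp_pos _).le).2 fun z => ?_
      rw [exp_smul_coordinateOn_apply]
      refine (Complex.norm_exp_le_exp_norm _).trans ?_
      rw [norm_mul, norm_neg, mul_comm]
      gcongr
      exact (coordinateOn K).norm_coe_le_norm z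
    · refine hφA _ (Subalgebra.le_topologicalClosure _ ?_)
      refine Algebra.subset_adjoin ⟨⟨k, hk⟩, ?_⟩
      ext z
      rw [exp_smul_coordinateOn_apply]
      have hk0 : (k : ℂ) ≠ 0 := by exact_mod_cast (by omega : k ≠ 0)
      change (k : ℂ) ^ (-(z : ℂ)) = _
      rw [Complex.cpow_def_of_ne_zero hk0, Complex.natCast_log]
      ring_nf
  have h0 : φ (-(NormedSpace.exp ((-0 : ℂ) • coordinateOn K) * coordinateOn K)) = 0 := by
    refine (hderiv 0).unique ?_
    rw [show F = fun _ => 0 from funext hF0]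
    exact hasDerivAt_const _ _
  simp only [neg_zero, zero_smul, NormedSpace.exp_zero, one_mul, map_neg, neg_eq_zero] at h0
  change ψ (S.mkQ (coordinateOn K)) = 0 at h0
  rw [hψ] at h0
  exact one_ne_zero h0

lemma exists_dirichlet_near_of_mem_closure [CompactSpace K] {g : C(K, ℂ)}
    (hg : g ∈ (dirichletAlgebraOn K).topologicalClosure) {ε : ℝ} (hε : 0 < ε) :
    ∃ D ∈ dirichletAlgebra, ∀ z : K, ‖D z - g z‖ < ε := by
  obtain ⟨f, hf, hfg⟩ := Metric.mem_closure_iff.1 hg ε hε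
  obtain ⟨D, hD, hfD⟩ := exists_mem_dirichletAlgebra_eqOn hf
  refine ⟨D, hD, fun z => ?_⟩
  rw [← hfD, ← dist_eq_norm, dist_comm]
  exact (ContinuousMap.dist_apply_le_dist z).trans_lt hfg

lemma entire_mem_topologicalClosure [CompactSpace K] {E : ℂ → ℂ} (hE : Differentiable ℂ E)
    {g : C(K, ℂ)} (hg : ∀ z : K, g z = E z) :
    g ∈ (dirichletAlgebraOn K).topologicalClosure := by
  have hp := hE.hasFPowerSeriesOnBall 0 (R := 1) one_pos
  set p := cauchyPowerSeries E 0 (1 : NNReal)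
  have hu := hp.tendstoUniformlyOn (r' := ‖coordinateOn K‖₊ + 1) ENNReal.coe_lt_top
  let q : ℕ → C(K, ℂ) := fun n => ∑ k ∈ Finset.range n, p.coeff k • coordinateOn K ^ k
  have hq : Filter.Tendsto q Filter.atTop (nhds g) := by
    rw [ContinuousMap.tendsto_iff_tendstoUniformly, Metric.tendstoUniformly_iff]
    intro ε hε
    filter_upwards [Metric.tendstoUniformlyOn_iff.1 hu ε hε] with n hn z
    have hz := hn z (by
      rw [mem_ball_zero_iff]
      have : ‖(z : ℂ)‖ ≤ ‖coordinateOn K‖ := (coordinateOn K).norm_coe_le_norm z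
      push_cast
      linarith)
    convert! hz using 2
    · rw [hg, zero_add]
    · simp [q, FormalMultilinearSeries.partialSum, coordinateOn, mul_comm]
  refine (Subalgebra.isClosed_topologicalClosure _).mem_of_tendsto hq
    (Filter.Eventually.of_forall fun n => sum_mem fun k _ => ?_)
  exact Subalgebra.smul_mem _ (pow_mem coordinateOn_mem_topologicalClosure k) _

/-- Pole pushing: `(z - w)⁻¹` is a uniform limit of Dirichlet polynomials when `w` lies in an
unbounded connected subset of the complement. -/
lemma exists_inv_sub_mem_topologicalClosure [CompactSpace K] {U : Set ℂ} (hU : IsPreconnected U)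
    (hUK : Disjoint U K) (hUb : ¬ Bornology.IsBounded U) {w : ℂ} (hw : w ∈ U) :
    ∃ g ∈ (dirichletAlgebraOn K).topologicalClosure, ∀ z : K, g z = ((z : ℂ) - w)⁻¹ := by
  have hclosed : IsClosed ((dirichletAlgebraOn K).topologicalClosure : Set C(K, ℂ)) :=
    Subalgebra.isClosed_topologicalClosure _
  let x : (dirichletAlgebraOn K).topologicalClosure :=
    ⟨coordinateOn K, coordinateOn_mem_topologicalClosure⟩
  have hspec : spectrum ℂ (x : C(K, ℂ)) = K := by
    rw [ContinuousMap.spectrum_eq_range]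
    exact Subtype.range_coe
  have hwx : w ∉ spectrum ℂ x := by
    intro h
    refine hUb ((Subalgebra.spectrum_isBounded_connectedComponentIn _ x h).subset ?_)
    rw [hspec]
    exact hU.subset_connectedComponentIn hw hUK.subset_compl_right
  rw [spectrum.notMem_iff] at hwx
  obtain ⟨u, hu⟩ := hwx
  refine ⟨-(((u⁻¹ : _ˣ) : (dirichletAlgebraOn K).topologicalClosure) : C(K, ℂ)),
    neg_mem (Subtype.property _), fun z => ?_⟩
  have h := congr_arg (fun f : (dirichletAlgebraOn K).topologicalClosure => (f : C(K, ℂ)) z)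
    u.mul_inv
  rw [hu] at h
  change (w - (z : ℂ)) * (((u⁻¹ : _ˣ) : (dirichletAlgebraOn K).topologicalClosure) : C(K, ℂ)) z = 1
    at h
  rw [ContinuousMap.neg_apply]
  refine eq_inv_of_mul_eq_one_left ?_
  linear_combination h

lemma isPreconnected_strip (a b : ℝ) : IsPreconnected {z : ℂ | a < z.re ∧ z.re < b} :=
  ((convex_halfSpace_re_gt a).inter (convex_halfSpace_re_lt b)).isPreconnected

lemma not_isBounded_strip {a b : ℝ} (hab : a < b) :
    ¬ Bornology.IsBounded {z : ℂ | a < z.re ∧ z.re < b} := by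
  intro h
  obtain ⟨C, hC⟩ := h.exists_norm_le
  have := (Complex.abs_im_le_norm _).trans
    (hC (⟨(a + b) / 2, |C| + 1⟩ : ℂ) ⟨by simp; linarith, by simp; linarith⟩)
  rw [abs_of_pos (by positivity)] at this
  linarith [le_abs_self C]

lemma exists_dirichlet_near_zeta {M : Set ℂ} (hM : IsCompact M) {ε : ℝ} (hε : 0 < ε)
    (hball : ∀ z ∈ M, ε ≤ ‖z - 1‖) (hstrip : ∀ z ∈ M, ¬ (1 < z.re ∧ z.re < 1 + ε)) (c : ℂ)
    {δ : ℝ} (hδ : 0 < δ) :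
    ∃ D ∈ dirichletAlgebra, ∀ z ∈ insert 1 M,
      ‖D z - Function.update riemannZeta 1 c z‖ < δ := by
  have : CompactSpace (insert 1 M : Set ℂ) := isCompact_iff_compactSpace.1 (hM.insert 1)
  set c' : ℂ := c - riemannZeta₀ 1
  obtain ⟨t, ⟨ht0, htε⟩, ht⟩ : ∃ t : ℝ, (0 < t ∧ t < ε / 2) ∧
      t * (2 / ε ^ 2) + (‖c'‖ * t ^ 2 + t) * (4 / ε ^ 2) < δ / 2 := by
    have hcont : Continuous fun t : ℝ => t * (2 / ε ^ 2) + (‖c'‖ * t ^ 2 + t) * (4 / ε ^ 2) := by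
      fun_prop
    have hev := (hcont.tendsto 0).eventually_lt_const (u := δ / 2) (by simpa using hδ)
    have hev' : ∀ᶠ t : ℝ in nhdsWithin 0 (Ioi 0), 0 < t ∧ t < ε / 2 :=
      Ioo_mem_nhdsGT (by positivity)
    exact (hev'.and (hev.filter_mono nhdsWithin_le_nhds)).exists
  obtain ⟨u, huA, hu⟩ := exists_inv_sub_mem_topologicalClosure (K := insert 1 M)
    (isPreconnected_strip 1 (1 + ε)) (by
      rw [Set.disjoint_left]
      rintro z hz (rfl | hzM)
      · simp at hz
      · exact hstrip z hzM hz) (not_isBounded_strip (by linarith)) (w := 1 + t)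
      (by simp; constructor <;> linarith)
  let E : C((insert 1 M : Set ℂ), ℂ) :=
    ⟨fun z => riemannZeta₀ z, differentiable_riemannZeta₀.continuous.comp continuous_subtype_val⟩
  have hEA := entire_mem_topologicalClosure (g := E) differentiable_riemannZeta₀ fun _ => rfl
  obtain ⟨D, hD, hDE⟩ := exists_dirichlet_near_of_mem_closure
    (add_mem (add_mem hEA huA) (Subalgebra.smul_mem _ (pow_mem huA 2) (c' * t ^ 2 + t)))
    (half_pos hδ)
  refine ⟨D, hD, fun z hz => ?_⟩
  have hDz := hDE ⟨z, hz⟩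
  simp only [ContinuousMap.add_apply, ContinuousMap.smul_apply, ContinuousMap.pow_apply, hu,
    smul_eq_mul] at hDz
  have htC : (t : ℂ) ≠ 0 := by exact_mod_cast ht0.ne'
  rcases eq_or_ne z 1 with rfl | hz1
  · rw [Function.update_self]
    refine lt_of_eq_of_lt ?_ (hDz.trans (half_lt_self hδ))
    congr 2
    simp only [E, ContinuousMap.coe_mk, c', sub_add_cancel_left, inv_neg]
    field_simp
    ring
  · have hzM : z ∈ M := hz.resolve_left hz1
    rw [Function.update_of_ne hz1, riemannZeta_eq_inv_sub_add hz1]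
    have hz0 : z - 1 ≠ 0 := sub_ne_zero.2 hz1
    have h1 : ε / 2 ≤ ‖z - (1 + t)‖ := by
      have h := norm_sub_norm_le (z - 1) (t : ℂ)
      rw [Complex.norm_real, Real.norm_of_nonneg ht0.le, sub_sub] at h
      linarith [hball z hzM]
    have hz2 : z - (1 + t) ≠ 0 := norm_pos_iff.1 (by linarith)
    have hinv : ‖(z - (1 + t))⁻¹‖ ≤ 2 / ε := by
      rw [norm_inv, inv_le_comm₀ (by linarith) (by positivity), inv_div]
      exact h1
    have hinv' : ‖(z - 1)⁻¹‖ ≤ 1 / ε := by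
      rw [norm_inv, inv_le_comm₀ (by linarith [hball z hzM]) (by positivity), one_div, inv_inv]
      exact hball z hzM
    have h2 : ‖(z - (1 + t))⁻¹ - (z - 1)⁻¹‖ ≤ t * (2 / ε ^ 2) := by
      have : (z - (1 + t))⁻¹ - (z - 1)⁻¹ = t * ((z - (1 + t))⁻¹ * (z - 1)⁻¹) := by
        field_simp
        ring
      rw [this, norm_mul, norm_mul, Complex.norm_real, Real.norm_of_nonneg ht0.le]
      calc _ ≤ t * ((2 / ε) * (1 / ε)) := by gcongr
        _ = _ := by field_simp
    have h3 : ‖(c' * t ^ 2 + t) * (z - (1 + t))⁻¹ ^ 2‖ ≤ (‖c'‖ * t ^ 2 + t) * (4 / ε ^ 2) := by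
      rw [norm_mul, norm_pow]
      calc _ ≤ (‖c'‖ * t ^ 2 + t) * (2 / ε) ^ 2 := by
            gcongr
            refine (norm_add_le _ _).trans_eq ?_
            rw [norm_mul, norm_pow, Complex.norm_real, Real.norm_of_nonneg ht0.le]
        _ = _ := by ring
    calc ‖D z - ((z - 1)⁻¹ + riemannZeta₀ z)‖
        = ‖(D z - (riemannZeta₀ z + (z - (1 + t))⁻¹ + (c' * t ^ 2 + t) * (z - (1 + t))⁻¹ ^ 2))
          + ((z - (1 + t))⁻¹ - (z - 1)⁻¹) + (c' * t ^ 2 + t) * (z - (1 + t))⁻¹ ^ 2‖ := by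
            congr 1; ring
      _ ≤ _ := norm_add₃_le
      _ < δ / 2 + δ / 2 := by
        have : ‖D z - (riemannZeta₀ z + (z - (1 + t))⁻¹ + (c' * t ^ 2 + t) * (z - (1 + t))⁻¹ ^ 2)‖
          < δ / 2 := hDz
        linarith
      _ = δ := add_halves δ

open ComplexConjugate

lemma exists_symmetrization {D : ℂ → ℂ} (hD : D ∈ dirichletAlgebra) :
    ∃ E ∈ dirichletAlgebra, (∀ z, E (conj z) = conj (E z)) ∧
      ∀ z, E z = (D z + conj (D (conj z))) / 2 := by
  refine ⟨(1 / 2 : ℂ) • (D + fun z => conj (D (conj z))),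
    Subalgebra.smul_mem _ (add_mem hD (conj_conj_mem_dirichletAlgebra hD)) _,
    fun z => ?_, fun z => ?_⟩
  · have h2 : conj (2 : ℂ) = 2 := Complex.conj_ofNat 2
    simp [add_comm, h2]
  · simp only [Pi.smul_apply, Pi.add_apply, smul_eq_mul]
    ring

lemma norm_symmetrization_sub_lt {D E f : ℂ → ℂ} (hE : ∀ z, E z = (D z + conj (D (conj z))) / 2)
    (hf : ∀ z, f (conj z) = conj (f z)) {δ : ℝ} {z : ℂ} (hz : ‖D z - f z‖ < δ)
    (hz' : ‖D (conj z) - f (conj z)‖ < δ) : ‖E z - f z‖ < δ := by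
  have h1 : ‖conj (D (conj z)) - f z‖ < δ := by
    rw [← Complex.norm_conj]
    simpa [hf] using hz'
  have h2 : E z - f z = ((D z - f z) + (conj (D (conj z)) - f z)) / 2 := by
    rw [hE]; ring
  rw [h2, norm_div, Complex.norm_ofNat, div_lt_iff₀ two_pos]
  linarith [norm_add_le (D z - f z) (conj (D (conj z)) - f z)]

lemma eval_comp_mem_dirichletAlgebra {w : ℂ → ℂ} (hw : w ∈ dirichletAlgebra)
    (q : Polynomial ℂ) : (fun z => q.eval (w z)) ∈ dirichletAlgebra := by
  induction q using Polynomial.induction_on' with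
  | add p q hp hq =>
    simp only [Polynomial.eval_add]
    exact add_mem hp hq
  | monomial n a =>
    simp only [Polynomial.eval_monomial]
    exact Subalgebra.smul_mem _ (pow_mem hw n) a

/-- There are real Dirichlet polynomials which serve as a local coordinate at each point of a given
finite set and separate these points. -/
lemma exists_dirichlet_coordinate (P : Finset ℂ) :
    ∃ w ∈ dirichletAlgebra, (∀ z, w (conj z) = conj (w z)) ∧ InjOn w P ∧
      ∀ a ∈ P, deriv w a ≠ 0 := by
  obtain ⟨R, hR⟩ := P.finite_toSet.isBounded.exists_norm_le
  obtain ⟨η, hη0, hη1, hηP⟩ : ∃ η : ℝ, 0 < η ∧ η < 1 ∧ ∀ a ∈ P, ∀ b ∈ P, a ≠ b →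
      η < ‖a - b‖ / 2 := by
    have h1 : ∀ᶠ η : ℝ in nhdsWithin 0 (Ioi 0), 0 < η ∧ η < 1 := Ioo_mem_nhdsGT one_pos
    have h2 : ∀ᶠ η : ℝ in nhdsWithin 0 (Ioi 0), ∀ a ∈ P, ∀ b ∈ P, a ≠ b → η < ‖a - b‖ / 2 := by
      simp only [Filter.eventually_all_finset, Filter.eventually_imp_distrib_left]
      intro a _ b _ hab
      exact (eventually_lt_nhds (half_pos (norm_pos_iff.2 (sub_ne_zero.2 hab)))).filter_mono
        nhdsWithin_le_nhds
    obtain ⟨η, ⟨h, h'⟩, h''⟩ := (h1.and h2).exists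
    exact ⟨η, h, h', h''⟩
  have : CompactSpace (Metric.closedBall (0 : ℂ) (R + 1)) :=
    isCompact_iff_compactSpace.1 (isCompact_closedBall _ _)
  obtain ⟨D, hD, hDz⟩ := exists_dirichlet_near_of_mem_closure
    (coordinateOn_mem_topologicalClosure (K := Metric.closedBall (0 : ℂ) (R + 1))) hη0
  obtain ⟨w, hw, hwc, hwD⟩ := exists_symmetrization hD
  have hwz : ∀ z, ‖z‖ ≤ R + 1 → ‖w z - z‖ < η := by
    intro z hz
    refine norm_symmetrization_sub_lt (f := id) hwD (fun _ => rfl)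
      (hDz ⟨z, by simpa using hz⟩) (hDz ⟨conj z, by simpa using hz⟩)
  refine ⟨w, hw, hwc, fun a ha b hb hab => ?_, fun a ha h0 => ?_⟩
  · by_contra hne
    have h1 := hwz a (by linarith [hR a ha])
    have h2 := hwz b (by linarith [hR b hb])
    have h3 := hηP a ha b hb hne
    have h4 := norm_sub_le (w b - b) (w a - a)
    rw [show w b - b - (w a - a) = a - b by rw [hab]; ring] at h4
    linarith
  · have hdiff := differentiable_of_mem_dirichletAlgebra hw
    have h := Complex.norm_deriv_le_of_forall_mem_sphere_norm_le (c := a) (C := η) one_pos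
      (f := fun z => w z - z) (hdiff.sub differentiable_id).diffContOnCl (fun z hz => by
        refine (hwz z ?_).le
        have h1 := norm_le_norm_add_norm_sub' z a
        have h2 : ‖z - a‖ = 1 := by simpa [dist_eq_norm] using hz
        linarith [hR a ha])
    rw [deriv_fun_sub hdiff.differentiableAt differentiableAt_fun_id, h0] at h
    simp at h
    linarith

/-- Uniform approximation by Dirichlet polynomials can be upgraded to interpolate the values at a
finite set `H`, with nonvanishing derivative there, and to miss the values at the other points of a
larger finite set `P`. -/
lemma exists_dirichlet_interpolating {N : Set ℂ} (hN : IsCompact N) (hNc : ∀ z ∈ N, conj z ∈ N)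
    {f : ℂ → ℂ} (hf : ∀ z, f (conj z) = conj (f z))
    (happrox : ∀ η : ℝ, 0 < η → ∃ D ∈ dirichletAlgebra, ∀ z ∈ N, ‖D z - f z‖ < η)
    {P H : Finset ℂ} (hHP : H ⊆ P) (hPN : ∀ a ∈ P, a ∈ N) (hPc : ∀ a ∈ P, conj a ∈ P)
    (hHc : ∀ a ∈ H, conj a ∈ H) {δ : ℝ} (hδ : 0 < δ) :
    ∃ D ∈ dirichletAlgebra, (∀ z, D (conj z) = conj (D z)) ∧ (∀ z ∈ N, ‖D z - f z‖ < δ) ∧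
      (∀ a ∈ H, D a = f a ∧ deriv D a ≠ 0) ∧ ∀ a ∈ P, a ∉ H → D a ≠ f a := by
  obtain ⟨w, hw, hwc, hinj, hderiv⟩ := exists_dirichlet_coordinate P
  have hwdiff := differentiable_of_mem_dirichletAlgebra hw
  let l : ℂ → ℂ → ℂ := fun a z => (Lagrange.basis P w a).eval (w z)
  have hl : ∀ a, l a ∈ dirichletAlgebra := fun a => eval_comp_mem_dirichletAlgebra hw _
  have hlcont : ∀ a, Continuous (l a) := fun a =>
    (differentiable_of_mem_dirichletAlgebra (hl a)).continuous
  obtain ⟨B, hB⟩ := hN.exists_bound_of_continuousOn (f := fun z => ∑ a ∈ P, ‖l a z‖)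
    (continuous_finsetSum _ fun a _ => (hlcont a).norm).continuousOn
  set η : ℝ := δ / (2 * (1 + |B|)) with hη
  have hη0 : 0 < η := by positivity
  obtain ⟨D₀, hD₀, hD₀f⟩ := happrox η hη0
  let D₁ : ℂ → ℂ := D₀ - ∑ a ∈ P, (D₀ a - f a) • l a
  have hD₁ : D₁ ∈ dirichletAlgebra :=
    sub_mem hD₀ (sum_mem fun a _ => Subalgebra.smul_mem _ (hl a) _)
  have hD₁apply : ∀ z, D₁ z = D₀ z - ∑ a ∈ P, (D₀ a - f a) * l a z := by
    intro z
    simp [D₁, Finset.sum_apply]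
  have hD₁P : ∀ b ∈ P, D₁ b = f b := by
    intro b hb
    rw [hD₁apply, Finset.sum_eq_single b]
    · simp only [l]
      rw [Lagrange.eval_basis_self hinj hb]
      ring
    · intro a _ hab
      simp only [l]
      rw [Lagrange.eval_basis_of_ne hab hb, mul_zero]
    · exact fun h => absurd hb h
  have hD₁f : ∀ z ∈ N, ‖D₁ z - f z‖ < δ / 2 := by
    intro z hz
    have hsum : ‖∑ a ∈ P, (D₀ a - f a) * l a z‖ ≤ η * |B| := by
      calc ‖∑ a ∈ P, (D₀ a - f a) * l a z‖ ≤ ∑ a ∈ P, ‖(D₀ a - f a) * l a z‖ := norm_sum_le _ _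
        _ ≤ ∑ a ∈ P, η * ‖l a z‖ := by
          refine Finset.sum_le_sum fun a ha => ?_
          rw [norm_mul]
          gcongr
          exact (hD₀f a (hPN a ha)).le
        _ = η * ∑ a ∈ P, ‖l a z‖ := by rw [Finset.mul_sum]
        _ ≤ η * |B| := by
          gcongr
          exact (le_abs_self _).trans ((hB z hz).trans (le_abs_self B))
    calc ‖D₁ z - f z‖ = ‖(D₀ z - f z) - ∑ a ∈ P, (D₀ a - f a) * l a z‖ := by
          rw [hD₁apply]; congr 1; ring
      _ ≤ ‖D₀ z - f z‖ + ‖∑ a ∈ P, (D₀ a - f a) * l a z‖ := norm_sub_le _ _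
      _ < η + η * |B| := add_lt_add_of_lt_of_le (hD₀f z hz) hsum
      _ = δ / 2 := by rw [hη]; field_simp
  obtain ⟨D₂, hD₂, hD₂c, hD₂D₁⟩ := exists_symmetrization hD₁
  have hD₂P : ∀ b ∈ P, D₂ b = f b := by
    intro b hb
    rw [hD₂D₁, hD₁P b hb, hD₁P _ (hPc b hb), hf, Complex.conj_conj]
    ring
  have hD₂f : ∀ z ∈ N, ‖D₂ z - f z‖ < δ / 2 := fun z hz =>
    norm_symmetrization_sub_lt hD₂D₁ hf (hD₁f z hz) (hD₁f _ (hNc z hz))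
  let q : Polynomial ℂ := ∏ a ∈ H, (Polynomial.X - Polynomial.C (w a))
  let Q : ℂ → ℂ := fun z => q.eval (w z)
  have hQ : Q ∈ dirichletAlgebra := eval_comp_mem_dirichletAlgebra hw q
  have hQdiff := differentiable_of_mem_dirichletAlgebra hQ
  have hQapply : ∀ z, Q z = ∏ a ∈ H, (w z - w a) := fun z => by
    simp [Q, q, Polynomial.eval_prod]
  have hQc : ∀ z, Q (conj z) = conj (Q z) := by
    intro z
    rw [hQapply, hQapply, map_prod]
    refine Finset.prod_bij (fun a _ => conj a) hHc
      (fun a _ b _ hab => (starRingEnd ℂ).injective hab)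
      (fun b hb => ⟨conj b, hHc b hb, Complex.conj_conj b⟩) fun a _ => ?_
    rw [hwc, hwc, map_sub, Complex.conj_conj]
  have hQH : ∀ a ∈ H, Q a = 0 := fun a ha => by
    rw [hQapply]
    exact Finset.prod_eq_zero ha (sub_self _)
  have hQne : ∀ a ∈ P, a ∉ H → Q a ≠ 0 := by
    intro a ha haH
    rw [hQapply, Finset.prod_ne_zero_iff]
    intro b hb h
    exact haH (hinj ha (hHP hb) (sub_eq_zero.1 h) ▸ hb)
  have hQderiv : ∀ a ∈ H, deriv Q a ≠ 0 := by
    intro a ha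
    have h := (q.hasDerivAt (w a)).comp a (hwdiff a).hasDerivAt
    have h' : HasDerivAt Q _ a := h
    rw [h'.deriv]
    refine mul_ne_zero ?_ (hderiv a (hHP ha))
    simp only [q]
    rw [Polynomial.derivative_prod_finset, Polynomial.eval_finsetSum, Finset.sum_eq_single a]
    · simp only [Polynomial.derivative_X_sub_C, mul_one, Polynomial.eval_prod,
        Polynomial.eval_sub, Polynomial.eval_X, Polynomial.eval_C, Finset.prod_ne_zero_iff]
      intro b hb h
      rw [Finset.mem_erase] at hb
      exact hb.1 (hinj (hHP ha) (hHP hb.2) (sub_eq_zero.1 h)).symm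
    · intro b _ hba
      simp only [Polynomial.derivative_X_sub_C, mul_one, Polynomial.eval_prod,
        Polynomial.eval_sub, Polynomial.eval_X, Polynomial.eval_C]
      exact Finset.prod_eq_zero (Finset.mem_erase.2 ⟨hba.symm, ha⟩) (sub_self _)
    · exact fun h => absurd ha h
  obtain ⟨B', hB'⟩ := hN.exists_bound_of_continuousOn hQdiff.continuous.continuousOn
  obtain ⟨s, ⟨hs0, hs1⟩, hs⟩ := (Ioo_infinite (show (0 : ℝ) < δ / (2 * (1 + |B'|)) by
    positivity)).exists_notMem_finset (H.image fun a => (-(deriv D₂ a / deriv Q a)).re)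
  have hs0' : (s : ℂ) ≠ 0 := by exact_mod_cast hs0.ne'
  refine ⟨D₂ + (s : ℂ) • Q, add_mem hD₂ (Subalgebra.smul_mem _ hQ _), fun z => ?_, fun z hz => ?_,
    fun a ha => ⟨?_, fun h => ?_⟩, fun a ha haH => ?_⟩
  · simp [hD₂c, hQc]
  · have h1 : ‖(s : ℂ) * Q z‖ ≤ δ / 2 := by
      rw [norm_mul, Complex.norm_real, Real.norm_of_nonneg hs0.le]
      calc s * ‖Q z‖ ≤ δ / (2 * (1 + |B'|)) * (1 + |B'|) := by
            gcongr
            linarith [hB' z hz, le_abs_self B']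
        _ = δ / 2 := by field_simp
    calc ‖(D₂ + (s : ℂ) • Q) z - f z‖ = ‖(D₂ z - f z) + s * Q z‖ := by
          simp only [Pi.add_apply, Pi.smul_apply, smul_eq_mul]
          congr 1; ring
      _ ≤ ‖D₂ z - f z‖ + ‖s * Q z‖ := norm_add_le _ _
      _ < δ := by linarith [hD₂f z hz]
  · simp [hQH a ha, hD₂P a (hHP ha)]
  · have hD₂diff := differentiable_of_mem_dirichletAlgebra hD₂
    rw [deriv_add (hD₂diff a) ((hQdiff a).const_smul _), deriv_const_smul _ (hQdiff a),
      smul_eq_mul] at h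
    refine hs (Finset.mem_image.2 ⟨a, ha, ?_⟩)
    have : -(deriv D₂ a / deriv Q a) = s := by
      have := hQderiv a ha
      field_simp
      linear_combination -h
    rw [this, Complex.ofReal_re]
  · simpa [hD₂P a ha, hs0'] using hQne a ha haH

/-- The closed disc of radius `n` with a disc around `1` and a vertical strip to the right of `1`
removed. -/
def slitDisc (r : ℝ) (n : ℕ) : Set ℂ :=
  {z | ‖z‖ ≤ n ∧ r / (n + 1) ≤ ‖z - 1‖ ∧ ¬ (1 < z.re ∧ z.re < 1 + r / (n + 1))}

/-- The part of the slit disc staying away from the zeros of `ζ`. -/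
def zeroFreePart (r : ℝ) (n : ℕ) : Set ℂ :=
  {z | z ∈ slitDisc r n ∧ ∀ a ∈ riemannZetaZeros, 1 / ((n : ℝ) + 1) ≤ ‖z - a‖}

/-- The compact exhaustion of the plane in which `1` and the zeros of `ζ` are isolated points. -/
noncomputable def zetaExhaustion (r : ℝ) (n : ℕ) : Set ℂ :=
  insert 1 (Metric.closedBall 0 n ∩ riemannZetaZeros) ∪ zeroFreePart r n

lemma isCompact_slitDisc (r : ℝ) (n : ℕ) : IsCompact (slitDisc r n) := by
  refine Metric.isCompact_of_isClosed_isBounded ?_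
    (Metric.isBounded_closedBall.subset fun z hz => mem_closedBall_zero_iff.2 hz.1)
  refine (isClosed_le continuous_norm continuous_const).inter
    ((isClosed_le continuous_const (continuous_id.sub continuous_const).norm).inter ?_)
  exact ((isOpen_lt continuous_const Complex.continuous_re).inter
    (isOpen_lt Complex.continuous_re continuous_const)).isClosed_compl

lemma isCompact_zeroFreePart (r : ℝ) (n : ℕ) : IsCompact (zeroFreePart r n) := by
  refine (isCompact_slitDisc r n).inter_right
    (t := {z | ∀ a ∈ riemannZetaZeros, 1 / ((n : ℝ) + 1) ≤ ‖z - a‖}) ?_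
  simp only [ofPred_forall]
  exact isClosed_biInter fun a _ => isClosed_le continuous_const (by fun_prop)

lemma finite_zeros_in_closedBall (n : ℕ) :
    (Metric.closedBall (0 : ℂ) n ∩ riemannZetaZeros).Finite :=
  (isCompact_closedBall _ _).inter_riemannZetaZeros_finite

lemma isCompact_zetaExhaustion (r : ℝ) (n : ℕ) : IsCompact (zetaExhaustion r n) :=
  ((finite_zeros_in_closedBall n).insert 1).isCompact.union (isCompact_zeroFreePart r n)

lemma monotone_zetaExhaustion {r : ℝ} (hr : 0 < r) : Monotone (zetaExhaustion r) := by
  intro m n hmn z hz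
  have hmn' : (m : ℝ) ≤ n := by exact_mod_cast hmn
  have hr' : r / ((n : ℝ) + 1) ≤ r / (m + 1) := by gcongr
  rcases hz with (rfl | ⟨hz, hz'⟩) | ⟨⟨h1, h2, h3⟩, h4⟩
  · exact Or.inl (Or.inl rfl)
  · exact Or.inl (Or.inr ⟨Metric.closedBall_subset_closedBall hmn' hz, hz'⟩)
  · refine Or.inr ⟨⟨h1.trans hmn', hr'.trans h2, fun h => h3 ⟨h.1, by linarith [h.2]⟩⟩,
      fun a ha => le_trans ?_ (h4 a ha)⟩
    gcongr

lemma iUnion_zetaExhaustion (r : ℝ) : ⋃ n, zetaExhaustion r n = univ := by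
  refine eq_univ_of_forall fun z => mem_iUnion.2 ?_
  obtain ⟨n₀, hn₀⟩ := exists_nat_ge ‖z‖
  by_cases hz1 : z = 1
  · exact ⟨0, Or.inl (Or.inl hz1)⟩
  by_cases hzZ : z ∈ riemannZetaZeros
  · exact ⟨n₀, Or.inl (Or.inr ⟨mem_closedBall_zero_iff.2 hn₀, hzZ⟩)⟩
  have hlim : ∀ c : ℝ, Filter.Tendsto (fun n : ℕ => c / ((n : ℝ) + 1)) Filter.atTop (nhds 0) :=
    fun c => tendsto_const_nhds.div_atTop
      (Filter.tendsto_atTop_add_const_right _ _ tendsto_natCast_atTop_atTop)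
  have hev1 : ∀ᶠ n : ℕ in Filter.atTop, ‖z‖ ≤ n :=
    tendsto_natCast_atTop_atTop.eventually_ge_atTop _
  have hev2 : ∀ᶠ n : ℕ in Filter.atTop, r / ((n : ℝ) + 1) ≤ ‖z - 1‖ :=
    (hlim r).eventually_le_const (norm_pos_iff.2 (sub_ne_zero.2 hz1))
  have hev3 : ∀ᶠ n : ℕ in Filter.atTop, ¬ (1 < z.re ∧ z.re < 1 + r / ((n : ℝ) + 1)) := by
    by_cases hre : 1 < z.re
    · filter_upwards [(hlim r).eventually_le_const (sub_pos.2 hre)] with n hn h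
      linarith [h.2]
    · exact Filter.Eventually.of_forall fun n h => hre h.1
  obtain ⟨ε, hε, hball⟩ := Metric.isOpen_iff.1 isClosed_riemannZetaZeros.isOpen_compl z hzZ
  have hev4 : ∀ᶠ n : ℕ in Filter.atTop, 1 / ((n : ℝ) + 1) ≤ ε :=
    (hlim 1).eventually_le_const hε
  obtain ⟨n, h1, h2, h3, h4⟩ := (hev1.and (hev2.and (hev3.and hev4))).exists
  refine ⟨n, Or.inr ⟨⟨h1, h2, h3⟩, fun a ha => h4.trans ?_⟩⟩
  by_contra! h
  refine hball ?_ ha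
  rwa [Metric.mem_ball, dist_comm, dist_eq_norm]

lemma riemannZeta_ne_zero_of_mem_zeroFreePart {r : ℝ} {n : ℕ} {z : ℂ}
    (hz : z ∈ zeroFreePart r n) : riemannZeta z ≠ 0 := by
  intro h
  have := hz.2 z h
  rw [sub_self, norm_zero] at this
  exact absurd this (not_le.2 (by positivity))

lemma ne_one_of_mem_slitDisc {r : ℝ} (hr : 0 < r) {n : ℕ} {z : ℂ} (hz : z ∈ slitDisc r n) :
    z ≠ 1 := by
  rintro rfl
  have := hz.2.1
  rw [sub_self, norm_zero] at this
  exact absurd this (not_le.2 (by positivity))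

lemma exists_pos_le_norm_riemannZeta {r : ℝ} (hr : 0 < r) (n : ℕ) :
    ∃ δ > 0, ∀ z ∈ zeroFreePart r n, δ ≤ ‖riemannZeta z‖ := by
  rcases (zeroFreePart r n).eq_empty_or_nonempty with h | h
  · exact ⟨1, one_pos, by simp [h]⟩
  · have hcont : ContinuousOn (fun z => ‖riemannZeta z‖) (zeroFreePart r n) := fun z hz =>
      (differentiableAt_riemannZeta (ne_one_of_mem_slitDisc hr hz.1)).continuousAt.norm
        |>.continuousWithinAt
    obtain ⟨z₀, hz₀, hmin⟩ := (isCompact_zeroFreePart r n).exists_isMinOn h hcont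
    exact ⟨_, norm_pos_iff.2 (riemannZeta_ne_zero_of_mem_zeroFreePart hz₀), fun z hz => hmin hz⟩

lemma conj_mem_realAxisUnionCriticalLine {z : ℂ} (hz : z ∈ realAxisUnionCriticalLine) :
    conj z ∈ realAxisUnionCriticalLine := by
  simpa [realAxisUnionCriticalLine] using hz

lemma exists_dirichlet_on_zetaExhaustion {r : ℝ} (hr : 0 < r)
    (hzero : ∀ a ∈ riemannZetaZeros, r ≤ ‖a - 1‖) (n : ℕ) :
    ∃ D : ℂ → ℂ, IsDirichletPolynomial D ∧
      (∀ z ∈ zetaExhaustion r n \ {1}, ‖D z - riemannZeta z‖ ≤ 1 / (n + 1)) ∧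
      (D 1 = (n + 1 : ℂ)) ∧
      (∀ z ∈ zetaExhaustion r n ∩ realAxisUnionCriticalLine,
        (D z = 0 ↔ riemannZeta z = 0) ∧ (D z = 0 → deriv D z ≠ 0)) ∧
      (∀ z ∈ zetaExhaustion r n \ realAxisUnionCriticalLine, D z ≠ 0) ∧
      (∀ x : ℝ, (D (x : ℂ)).im = 0) := by
  classical
  set f : ℂ → ℂ := Function.update riemannZeta 1 (n + 1 : ℂ) with hfdef
  have hf1 : f 1 = n + 1 := Function.update_self ..
  have hfne : ∀ {z}, z ≠ 1 → f z = riemannZeta z := fun hz => Function.update_of_ne hz ..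
  have hn1 : (n + 1 : ℂ) ≠ 0 := by exact_mod_cast n.succ_ne_zero
  have hfc : ∀ z, f (conj z) = conj (f z) := by
    intro z
    rcases eq_or_ne z 1 with rfl | hz
    · simp [hf1]
    · rw [hfne hz, hfne (fun h => hz (by simpa using congr_arg conj h)), riemannZeta_conj]
  have hrn : 0 < r / ((n : ℝ) + 1) := by positivity
  have hrn' : r / ((n : ℝ) + 1) ≤ r := div_le_self hr.le (by linarith [n.cast_nonneg (α := ℝ)])
  let T : Finset ℂ := (finite_zeros_in_closedBall n).toFinset
  have hT : ∀ {a}, a ∈ T ↔ ‖a‖ ≤ n ∧ riemannZeta a = 0 := by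
    simp [T, mem_riemannZetaZeros]
  have hTc : ∀ a ∈ T, conj a ∈ T := by
    intro a ha
    rw [hT] at ha ⊢
    rw [Complex.norm_conj, riemannZeta_conj, ha.2, map_zero]
    exact ⟨ha.1, rfl⟩
  have hTslit : ∀ a ∈ T, a ∈ slitDisc r n := by
    intro a ha
    rw [hT] at ha
    exact ⟨ha.1, hrn'.trans (hzero a ha.2),
      fun h => riemannZeta_ne_zero_of_one_le_re h.1.le ha.2⟩
  let H : Finset ℂ := insert 1 (T.filter (· ∈ realAxisUnionCriticalLine))
  obtain ⟨δ, hδ, hδζ⟩ := exists_pos_le_norm_riemannZeta hr n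
  obtain ⟨D, hD, hDc, hDf, hDH, hDP⟩ := exists_dirichlet_interpolating
    (N := insert 1 (slitDisc r n)) (f := f) (P := insert 1 T) (H := H)
    (δ := min δ (1 / (n + 1))) ((isCompact_slitDisc r n).insert 1)
    (by
      rintro z (rfl | ⟨h1, h2, h3⟩)
      · simp
      · refine Or.inr ⟨by simpa using h1, ?_, by simpa using h3⟩
        rw [← Complex.norm_conj]
        simpa using h2)
    hfc
    (fun η hη => exists_dirichlet_near_zeta (isCompact_slitDisc r n) hrn (fun z hz => hz.2.1)
      (fun z hz => hz.2.2) _ hη)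
    (Finset.insert_subset_insert _ (Finset.filter_subset _ _))
    (fun a ha => (Finset.mem_insert.1 ha).imp id (hTslit a))
    (fun a ha => by
      rcases Finset.mem_insert.1 ha with rfl | ha
      · simp
      · exact Finset.mem_insert_of_mem (hTc a ha))
    (fun a ha => by
      rcases Finset.mem_insert.1 ha with rfl | ha
      · simp [H]
      · rw [Finset.mem_filter] at ha
        exact Finset.mem_insert_of_mem (Finset.mem_filter.2
          ⟨hTc a ha.1, conj_mem_realAxisUnionCriticalLine ha.2⟩))
    (lt_min hδ (by positivity))
  have hD1 : D 1 = n + 1 := (hDH 1 (Finset.mem_insert_self _ _)).1.trans hf1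
  have hDT : ∀ a ∈ T, a ∈ realAxisUnionCriticalLine → D a = 0 ∧ deriv D a ≠ 0 := by
    intro a ha haL
    obtain ⟨h1, h2⟩ := hDH a (Finset.mem_insert_of_mem (Finset.mem_filter.2 ⟨ha, haL⟩))
    rw [hfne (ne_one_of_mem_slitDisc hr (hTslit a ha)), (hT.1 ha).2] at h1
    exact ⟨h1, h2⟩
  have hDT' : ∀ a ∈ T, a ∉ realAxisUnionCriticalLine → D a ≠ 0 := by
    intro a ha haL
    have ha1 := ne_one_of_mem_slitDisc hr (hTslit a ha)
    have h := hDP a (Finset.mem_insert_of_mem ha) (fun h => by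
      rcases Finset.mem_insert.1 h with h | h
      · exact ha1 h
      · exact haL (Finset.mem_filter.1 h).2)
    rwa [hfne ha1, (hT.1 ha).2] at h
  have hDfree : ∀ z ∈ zeroFreePart r n, D z ≠ 0 := by
    intro z hz h0
    have h := hDf z (Or.inr hz.1)
    rw [h0, zero_sub, norm_neg, hfne (ne_one_of_mem_slitDisc hr hz.1)] at h
    exact absurd (h.trans_le (min_le_left _ _)) (not_lt.2 (hδζ z hz))
  have hcases : ∀ z ∈ zetaExhaustion r n, z = 1 ∨ z ∈ T ∨ z ∈ zeroFreePart r n := by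
    rintro z ((h | h) | h)
    · exact Or.inl h
    · exact Or.inr (Or.inl ((finite_zeros_in_closedBall n).mem_toFinset.2 h))
    · exact Or.inr (Or.inr h)
  refine ⟨D, isDirichletPolynomial_of_mem_dirichletAlgebra hD, ?_, hD1, ?_, ?_, fun x => ?_⟩
  · rintro z ⟨hz, hz1⟩
    have hzslit : z ∈ slitDisc r n := by
      rcases hcases z hz with h | h | h
      · exact absurd h hz1
      · exact hTslit z h
      · exact h.1
    rw [← hfne hz1]
    exact (hDf z (Or.inr hzslit)).le.trans (min_le_right _ _)
  · rintro z ⟨hz, hzL⟩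
    rcases hcases z hz with rfl | h | h
    · have : D 1 ≠ 0 := hD1 ▸ hn1
      exact ⟨iff_of_false this riemannZeta_one_ne_zero, fun h => absurd h this⟩
    · exact ⟨iff_of_true (hDT z h hzL).1 (hT.1 h).2, fun _ => (hDT z h hzL).2⟩
    · exact ⟨iff_of_false (hDfree z h) (riemannZeta_ne_zero_of_mem_zeroFreePart h),
        fun h0 => absurd h0 (hDfree z h)⟩
  · rintro z ⟨hz, hzL⟩
    rcases hcases z hz with rfl | h | h
    · exact hD1 ▸ hn1
    · exact hDT' z h hzL
    · exact hDfree z h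
  · have h := hDc x
    rw [Complex.conj_ofReal] at h
    exact Complex.conj_eq_iff_im.1 h.symm

/-- There exists an increasing sequence `K_n` of compact subsets of `ℂ` with union `ℂ`,
and a sequence of Dirichlet polynomials `D_n` (indexed so that `D n` plays the role of
`D_{n+1}`), satisfying properties (1)-(5). -/
theorem zeta_approx_by_dirichlet_polynomials :
    ∃ (K : ℕ → Set ℂ) (D : ℕ → ℂ → ℂ),
      (∀ n, IsCompact (K n)) ∧
      Monotone K ∧
      (⋃ n, K n) = Set.univ ∧
      (∀ n, IsDirichletPolynomial (D n)) ∧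
      ∀ n : ℕ,
        (∀ z ∈ K n \ {1}, ‖D n z - riemannZeta z‖ ≤ 1 / (n + 1)) ∧
        (D n 1 = (n + 1 : ℂ)) ∧
        (∀ z ∈ K n ∩ realAxisUnionCriticalLine,
          (D n z = 0 ↔ riemannZeta z = 0) ∧
          (D n z = 0 → deriv (D n) z ≠ 0)) ∧
        (∀ z ∈ K n \ realAxisUnionCriticalLine, D n z ≠ 0) ∧
        (∀ x : ℝ, (D n (x : ℂ)).im = 0) := by
  obtain ⟨r, hr, hball⟩ := Metric.eventually_nhds_iff.1 riemannZeta_eventually_ne_zero_nhds_one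
  have hzero : ∀ a ∈ riemannZetaZeros, r ≤ ‖a - 1‖ := by
    intro a ha
    by_contra! h
    exact hball (by rwa [dist_eq_norm]) ha
  choose D hD hprop using exists_dirichlet_on_zetaExhaustion hr hzero
  exact ⟨zetaExhaustion r, D, isCompact_zetaExhaustion r, monotone_zetaExhaustion hr,
    iUnion_zetaExhaustion r, hD, hprop⟩
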